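/- arXiv:2212.00441 — 2 statements merged into one kernel-verified Lean document; each statement's English description precedes it below -/
import Mathlib

section
/- The operator T : L¹[0,1] → ℓ^∞ defined by Tf = (∫₀¹ f(t) r_k⁺(t) dt)_{k=1}^∞, where r_k are the Rademacher functions, is weak Dunford–Pettis but not Dunford–Pettis; in particular the Rademacher sequence (r_n) is weakly null in L¹[0,1] while ‖Tr_n‖_∞ ≥ 1/2 for all n. -/
open Filter Topology MeasureTheory

/-- Lebesgue measure on `[0,1]`. -/
noncomputable def muI : Measure ℝ := volume.restrict (Set.Icc 0 1)

/-- The `k`-th Rademacher function `r_k(t) = sgn (sin (2^k π t))` (here `k = 1, 2, …`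
is encoded as `k+1` for `k : ℕ`). -/
noncomputable def rademacher (k : ℕ) (t : ℝ) : ℝ :=
  Real.sign (Real.sin (2 ^ (k + 1) * Real.pi * t))

instance muI.isProbabilityMeasure : IsProbabilityMeasure muI :=
  ⟨by simp [muI]⟩

theorem integral_muI (f : ℝ → ℝ) : ∫ t, f t ∂muI = ∫ t in (0 : ℝ)..1, f t := by
  rw [intervalIntegral.integral_of_le zero_le_one, muI, integral_Icc_eq_integral_Ioc]

/-- A `1`-periodic function which is also antiperiodic has mean zero. -/
theorem integral_muI_eq_zero_of_antiperiodic {f : ℝ → ℝ} {c : ℝ} (h : Function.Periodic f 1)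
    (hc : Function.Antiperiodic f c) : ∫ t, f t ∂muI = 0 := by
  have h1 := h.intervalIntegral_add_eq 0 c
  have h2 := intervalIntegral.integral_comp_add_right (a := 0) (b := 1) f c
  simp only [hc _, intervalIntegral.integral_neg] at h2
  rw [integral_muI]
  rw [zero_add] at h1 h2
  rw [add_comm c 1] at h1
  linarith

theorem measurable_rademacher (k : ℕ) : Measurable (rademacher k) := by
  have : Measurable Real.sign := by
    unfold Real.sign
    exact Measurable.ite measurableSet_Iio measurable_const
      (Measurable.ite measurableSet_Ioi measurable_const measurable_const)
  exact this.comp (by fun_prop)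

theorem abs_rademacher_le_one (k : ℕ) (t : ℝ) : |rademacher k t| ≤ 1 := by
  unfold rademacher
  rcases Real.sign_apply_eq (Real.sin (2 ^ (k + 1) * Real.pi * t)) with h | h | h <;> simp [h]

theorem rademacher_antiperiodic (k : ℕ) :
    Function.Antiperiodic (rademacher k) ((2 ^ (k + 1))⁻¹) := by
  intro t
  have : (2 : ℝ) ^ (k + 1) * Real.pi * (t + (2 ^ (k + 1))⁻¹)
      = 2 ^ (k + 1) * Real.pi * t + Real.pi := by field_simp
  rw [rademacher, this, Real.sin_add_pi, Real.sign_neg, rademacher]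

theorem rademacher_periodic (k : ℕ) : Function.Periodic (rademacher k) ((2 ^ k)⁻¹) := by
  have := (rademacher_antiperiodic k).periodic
  rwa [show 2 • ((2 : ℝ) ^ (k + 1))⁻¹ = (2 ^ k)⁻¹ by
    rw [nsmul_eq_mul, pow_succ]; push_cast; field_simp] at this

theorem rademacher_periodic_of_le {j k : ℕ} (h : j ≤ k) :
    Function.Periodic (rademacher k) ((2 ^ j)⁻¹) := by
  have := (rademacher_periodic k).nat_mul (2 ^ (k - j))
  rwa [show ((2 ^ (k - j) : ℕ) : ℝ) * (2 ^ k)⁻¹ = (2 ^ j)⁻¹ by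
    obtain ⟨d, rfl⟩ := Nat.exists_eq_add_of_le h
    rw [Nat.add_sub_cancel_left, pow_add]; push_cast; field_simp] at this

theorem rademacher_periodic_one (k : ℕ) : Function.Periodic (rademacher k) 1 := by
  simpa using rademacher_periodic_of_le (Nat.zero_le k)

theorem integral_rademacher (k : ℕ) : ∫ t, rademacher k t ∂muI = 0 :=
  integral_muI_eq_zero_of_antiperiodic (rademacher_periodic_one k) (rademacher_antiperiodic k)

theorem integral_rademacher_mul_of_lt {j k : ℕ} (h : j < k) :
    ∫ t, rademacher j t * rademacher k t ∂muI = 0 := by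
  refine integral_muI_eq_zero_of_antiperiodic (c := (2 ^ (j + 1))⁻¹)
    ((rademacher_periodic_one j).mul (rademacher_periodic_one k)) fun t => ?_
  rw [rademacher_antiperiodic j, rademacher_periodic_of_le h, neg_mul]

theorem rademacher_mul_self_ae (k : ℕ) : ∀ᵐ t ∂muI, rademacher k t * rademacher k t = 1 := by
  have hc : (Set.range fun n : ℤ => (n : ℝ) / 2 ^ (k + 1)).Countable := Set.countable_range _
  refine ae_restrict_of_ae ?_
  filter_upwards [hc.ae_notMem volume] with t ht
  have : Real.sin (2 ^ (k + 1) * Real.pi * t) ≠ 0 := by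
    intro h0
    obtain ⟨n, hn⟩ := Real.sin_eq_zero_iff.1 h0
    refine ht ⟨n, ?_⟩
    have : (n : ℝ) = 2 ^ (k + 1) * t := by
      apply mul_right_cancel₀ Real.pi_ne_zero
      rw [hn]; ring
    simp only [this]
    field_simp
  rcases Real.sign_apply_eq_of_ne_zero _ this with h | h <;> simp [rademacher, h]

theorem memLp_rademacher (k : ℕ) (p : ENNReal) : MemLp (rademacher k) p muI :=
  MemLp.of_bound (measurable_rademacher k).aestronglyMeasurable 1
    (ae_of_all _ fun t => abs_rademacher_le_one k t)

theorem integral_rademacher_mul_posPart (k : ℕ) :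
    ∫ t, rademacher k t * max (rademacher k t) 0 ∂muI = 1 / 2 := by
  have h : ∀ᵐ t ∂muI, rademacher k t * max (rademacher k t) 0 = 1 / 2 + rademacher k t / 2 := by
    filter_upwards [rademacher_mul_self_ae k] with t ht
    rcases mul_self_eq_one_iff.1 ht with h | h <;> norm_num [h]
  rw [integral_congr_ae h, integral_add (integrable_const _)
    ((memLp_one_iff_integrable.1 (memLp_rademacher k 1)).div_const 2), integral_div 2 (rademacher k),
    integral_rademacher]
  simp

theorem orthonormal_rademacher :
    Orthonormal ℝ fun k => (memLp_rademacher k 2).toLp (rademacher k) := by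
  have key : ∀ j k, inner ℝ ((memLp_rademacher j 2).toLp (rademacher j))
      ((memLp_rademacher k 2).toLp (rademacher k)) = ∫ t, rademacher j t * rademacher k t ∂muI := by
    intro j k
    rw [L2.inner_def]
    refine integral_congr_ae ?_
    filter_upwards [(memLp_rademacher j 2).coeFn_toLp, (memLp_rademacher k 2).coeFn_toLp]
      with t h1 h2
    rw [h1, h2]
    simp [mul_comm]
  rw [orthonormal_iff_ite]
  intro j k
  rw [key]
  split_ifs with h
  · subst h
    rw [integral_congr_ae (rademacher_mul_self_ae j)]
    simp
  · rcases lt_or_gt_of_ne h with h | h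
    · exact integral_rademacher_mul_of_lt h
    · simp_rw [mul_comm (rademacher j _)]
      exact integral_rademacher_mul_of_lt h

theorem Orthonormal.tendsto_inner_zero {E : Type*} [NormedAddCommGroup E] [InnerProductSpace ℝ E]
    {v : ℕ → E} (hv : Orthonormal ℝ v) (x : E) :
    Tendsto (fun k => inner ℝ x (v k)) atTop (𝓝 0) := by
  have h := (hv.inner_products_summable (x := x)).tendsto_atTop_zero
  have h2 := h.sqrt
  simp only [Real.sqrt_sq (norm_nonneg _), Real.sqrt_zero] at h2
  simpa [real_inner_comm] using tendsto_zero_iff_norm_tendsto_zero.2 h2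

/-- The inclusion of `L²[0,1]` in `L¹[0,1]`. -/
noncomputable def inclusionL2L1 : Lp ℝ 2 muI →L[ℝ] Lp ℝ 1 muI :=
  LinearMap.mkContinuous
    { toFun := fun f => ((Lp.memLp f).mono_exponent one_le_two).toLp f
      map_add' := fun f g => by
        rw [← MemLp.toLp_add]
        exact MemLp.toLp_congr _ _ (Lp.coeFn_add f g)
      map_smul' := fun c f => by
        rw [RingHom.id_apply, ← MemLp.toLp_const_smul]
        exact MemLp.toLp_congr _ _ (Lp.coeFn_smul c f) } 1 fun f => by
    rw [one_mul, LinearMap.coe_mk, AddHom.coe_mk, Lp.norm_toLp, Lp.norm_def]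
    exact ENNReal.toReal_mono (Lp.memLp f).2.ne
      (eLpNorm_le_eLpNorm_of_exponent_le one_le_two (Lp.memLp f).1)

theorem tendsto_apply_rademacher {R : ℕ → Lp ℝ 1 muI}
    (hR : ∀ k, (R k : ℝ → ℝ) =ᵐ[muI] rademacher k) (φ : Lp ℝ 1 muI →L[ℝ] ℝ) :
    Tendsto (fun n => φ (R n)) atTop (𝓝 0) := by
  have h := orthonormal_rademacher.tendsto_inner_zero
    ((InnerProductSpace.toDual ℝ _).symm (φ ∘L inclusionL2L1))
  refine h.congr fun n => ?_
  rw [InnerProductSpace.toDual_symm_apply, ContinuousLinearMap.comp_apply]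
  congr 1
  apply Lp.ext
  exact (MemLp.coeFn_toLp ((Lp.memLp _).mono_exponent one_le_two)).trans
    ((MemLp.coeFn_toLp _).trans (hR n).symm)

theorem integrable_mul_rademacher {f : ℝ → ℝ} (hf : Integrable f muI) (k : ℕ) :
    Integrable (fun t => f t * rademacher k t) muI :=
  hf.mul_bdd (c := 1) (measurable_rademacher k).aestronglyMeasurable
    (ae_of_all _ fun t => abs_rademacher_le_one k t)

theorem tendsto_integral_mul_rademacher {f : ℝ → ℝ} (hf : Integrable f muI) :
    Tendsto (fun k => ∫ t, f t * rademacher k t ∂muI) atTop (𝓝 0) := by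
  refine Integrable.induction
    (fun f => Tendsto (fun k => ∫ t, f t * rademacher k t ∂muI) atTop (𝓝 0)) ?_ ?_ ?_ ?_ hf
  · intro c s hs hμ
    have h := (orthonormal_rademacher.tendsto_inner_zero
      (indicatorConstLp 2 hs hμ.ne (1 : ℝ))).const_mul c
    rw [mul_zero] at h
    refine h.congr fun k => ?_
    rw [L2.inner_indicatorConstLp_one, ← integral_const_mul, ← integral_indicator hs]
    refine integral_congr_ae ?_
    filter_upwards [(memLp_rademacher k 2).coeFn_toLp] with t ht
    by_cases hts : t ∈ s <;> simp [hts, ht]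
  · intro f g _ hf hg ihf ihg
    have h := ihf.add ihg
    rw [add_zero] at h
    refine h.congr fun k => ?_
    rw [← integral_add (integrable_mul_rademacher hf k) (integrable_mul_rademacher hg k)]
    simp [add_mul]
  · rw [← isSeqClosed_iff_isClosed]
    intro u f hu huf
    change Tendsto (fun k => ∫ t, f t * rademacher k t ∂muI) atTop (𝓝 0)
    rw [Metric.tendsto_atTop]
    intro ε hε
    obtain ⟨m, hm⟩ := ((Metric.tendsto_atTop.1 huf) (ε / 2) (half_pos hε)).imp fun N h => h N le_rfl
    obtain ⟨N, hN⟩ := (Metric.tendsto_atTop.1 (hu m)) (ε / 2) (half_pos hε)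
    refine ⟨N, fun k hk => ?_⟩
    have h1 := hN k hk
    have hd : |∫ t, f t * rademacher k t ∂muI - ∫ t, u m t * rademacher k t ∂muI|
        ≤ dist (u m) f := by
      rw [← integral_sub (integrable_mul_rademacher (L1.integrable_coeFn f) k)
        (integrable_mul_rademacher (L1.integrable_coeFn (u m)) k), dist_comm, dist_eq_norm,
        L1.norm_eq_integral_norm, ← Real.norm_eq_abs]
      refine norm_integral_le_of_norm_le (L1.integrable_coeFn (f - u m)).norm ?_
      filter_upwards [Lp.coeFn_sub f (u m)] with t ht
      rw [ht, Pi.sub_apply, ← sub_mul, norm_mul]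
      exact mul_le_of_le_one_right (norm_nonneg _) (abs_rademacher_le_one k t)
    rw [Real.dist_eq, sub_zero] at h1 ⊢
    have := abs_sub_abs_le_abs_sub (∫ t, f t * rademacher k t ∂muI)
      (∫ t, u m t * rademacher k t ∂muI)
    linarith
  · intro f g hfg _ ih
    refine ih.congr fun k => integral_congr_ae ?_
    filter_upwards [hfg] with t ht
    rw [ht]

/-- **Schur's theorem**: a sequence of summable families which tends to zero when tested against
all bounded sequences tends to zero in `ℓ¹`. -/
theorem tendsto_tsum_abs_zero_of_forall_tendsto {b : ℕ → ℕ → ℝ}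
    (hb : ∀ n, Summable fun k => |b n k|)
    (h : ∀ s : ℕ → Set.Icc (-1 : ℝ) 1, Tendsto (fun n => ∑' k, (s k : ℝ) * b n k) atTop (𝓝 0)) :
    Tendsto (fun n => ∑' k, |b n k|) atTop (𝓝 0) := by
  have habs (x : Set.Icc (-1 : ℝ) 1) : |(x : ℝ)| ≤ 1 := abs_le.2 x.2
  have hle (s : ℕ → Set.Icc (-1 : ℝ) 1) (n k : ℕ) : ‖(s k : ℝ) * b n k‖ ≤ |b n k| := by
    rw [norm_mul]
    exact mul_le_of_le_one_left (abs_nonneg _) (habs _)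
  have hsum (s : ℕ → Set.Icc (-1 : ℝ) 1) (n : ℕ) : Summable fun k => (s k : ℝ) * b n k :=
    (hb n).of_norm_bounded (hle s n)
  have hcoord (k : ℕ) : Tendsto (fun n => |b n k|) atTop (𝓝 0) := by
    have h1 := h fun j => if j = k then ⟨1, by norm_num⟩ else ⟨0, by norm_num⟩
    have h2 (n : ℕ) : ∑' j, (((if j = k then ⟨1, by norm_num⟩ else ⟨0, by norm_num⟩ :
        Set.Icc (-1 : ℝ) 1)) : ℝ) * b n j = b n k := by
      rw [tsum_eq_single k fun j hj => by simp [hj]]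
      simp
    simpa [h2] using h1.abs
  rw [Metric.tendsto_atTop]
  intro ε hε
  have : Nonempty (Set.Icc (-1 : ℝ) 1) := ⟨⟨0, by norm_num⟩⟩
  obtain ⟨N, s₀, hs₀⟩ := nonempty_interior_of_iUnion_of_closed
    (f := fun N => {s : ℕ → Set.Icc (-1 : ℝ) 1 | ∀ n ≥ N, |∑' k, (s k : ℝ) * b n k| ≤ ε / 4})
    (fun N => by
      simp only [Set.ofPred_forall]
      refine isClosed_iInter fun n => isClosed_iInter fun _ => isClosed_le ?_ continuous_const
      exact (continuous_tsum (fun k => by fun_prop) (hb n) fun k s => hle s n k).abs)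
    (by
      refine Set.eq_univ_of_forall fun s => Set.mem_iUnion.2 ?_
      obtain ⟨N, hN⟩ := Metric.tendsto_atTop.1 (h s) (ε / 4) (by positivity)
      exact ⟨N, fun n hn => by simpa using (hN n hn).le⟩)
  obtain ⟨I, u, hu, hI⟩ := isOpen_pi_iff.1 isOpen_interior s₀ hs₀
  have hIlim : Tendsto (fun n => ∑ k ∈ I, |b n k|) atTop (𝓝 0) := by
    simpa using tendsto_finsetSum I fun k _ => hcoord k
  obtain ⟨M, hM⟩ := Metric.tendsto_atTop.1 hIlim (ε / 4) (by positivity)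
  refine ⟨max N M, fun n hn => ?_⟩
  let s : ℕ → Set.Icc (-1 : ℝ) 1 := fun k =>
    if k ∈ I then s₀ k else if 0 ≤ b n k then ⟨1, by norm_num⟩ else ⟨-1, by norm_num⟩
  have hs : |∑' k, (s k : ℝ) * b n k| ≤ ε / 4 := by
    refine interior_subset (hI fun k hk => ?_) n (le_of_max_le_left hn)
    simpa [s, Finset.mem_coe.1 hk] using (hu k hk).2
  have hMn := hM n (le_of_max_le_right hn)
  have hpt (k : ℕ) : |b n k| ≤ s k * b n k + if k ∈ I then 2 * |b n k| else 0 := by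
    by_cases hk : k ∈ I
    · have := neg_le_of_abs_le (hle s n k)
      simp only [hk, if_true]
      linarith
    · by_cases h0 : 0 ≤ b n k
      · simp [s, hk, h0, abs_of_nonneg]
      · simp [s, hk, h0, abs_of_neg (not_le.1 h0)]
  have hfin : HasSum (fun k => if k ∈ I then 2 * |b n k| else 0) (∑ k ∈ I, 2 * |b n k|) := by
    have := hasSum_sum_of_ne_finset_zero (f := fun k => if k ∈ I then 2 * |b n k| else 0) (s := I)
      (L := .unconditional ℕ) fun k hk => if_neg hk
    rwa [Finset.sum_congr rfl fun k hk => if_pos hk] at this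
  have hfinal := hasSum_le hpt (hb n).hasSum ((hsum s n).hasSum.add hfin)
  rw [← Finset.mul_sum] at hfinal
  rw [Real.dist_eq, sub_zero, abs_of_nonneg (Finset.sum_nonneg fun _ _ => abs_nonneg _)] at hMn
  rw [Real.dist_eq, sub_zero, abs_of_nonneg (tsum_nonneg fun _ => abs_nonneg _)]
  have := le_of_abs_le hs
  linarith

/-- A weakly null sequence is bounded. -/
theorem exists_norm_le_of_forall_tendsto_zero {E : Type*} [NormedAddCommGroup E]
    [NormedSpace ℝ E] {x : ℕ → E} (h : ∀ φ : E →L[ℝ] ℝ, Tendsto (fun n => φ (x n)) atTop (𝓝 0)) :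
    ∃ C, ∀ n, ‖x n‖ ≤ C := by
  obtain ⟨C, hC⟩ := banach_steinhaus
    (g := fun n => NormedSpace.inclusionInDoubleDualLi (E := E) ℝ (x n)) fun φ => by
      obtain ⟨C, hC⟩ := (Metric.isBounded_range_of_tendsto _ (h φ)).exists_norm_le
      exact ⟨C, fun n => hC _ ⟨n, rfl⟩⟩
  exact ⟨C, fun n => by simpa only [LinearIsometry.norm_map] using hC n⟩

theorem lp_sum_single_apply (F : Finset ℕ) (c : ℕ → ℝ) (j : ℕ) :
    (∑ k ∈ F, c k • lp.single (E := fun _ : ℕ => ℝ) ⊤ k (1 : ℝ)) j = if j ∈ F then c j else 0 := by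
  rw [lp.coeFn_sum, Finset.sum_apply]
  simp [Pi.single_apply]

theorem sum_abs_apply_single_le (g : lp (fun _ : ℕ => ℝ) ⊤ →L[ℝ] ℝ) (F : Finset ℕ) :
    ∑ k ∈ F, |g (lp.single ⊤ k 1)| ≤ ‖g‖ := by
  have h1 : ∑ k ∈ F, |g (lp.single ⊤ k 1)|
      = g (∑ k ∈ F, Real.sign (g (lp.single ⊤ k 1)) • lp.single ⊤ k 1) := by
    simp only [map_sum, map_smul, smul_eq_mul]
    refine Finset.sum_congr rfl fun k _ => ?_
    rcases lt_trichotomy (g (lp.single ⊤ k 1)) 0 with h | h | h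
    · rw [Real.sign_of_neg h, abs_of_neg h, neg_one_mul]
    · simp [h]
    · rw [Real.sign_of_pos h, abs_of_pos h, one_mul]
  rw [h1]
  refine (le_abs_self _).trans ((g.le_opNorm _).trans (mul_le_of_le_one_right (norm_nonneg _) ?_))
  refine lp.norm_le_of_forall_le zero_le_one fun j => ?_
  rw [lp_sum_single_apply]
  split_ifs
  · rcases Real.sign_apply_eq (g (lp.single ⊤ j 1)) with h | h | h <;> simp [h]
  · simp

theorem summable_abs_apply_single (g : lp (fun _ : ℕ => ℝ) ⊤ →L[ℝ] ℝ) :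
    Summable fun k => |g (lp.single ⊤ k 1)| :=
  summable_of_sum_le (fun _ => abs_nonneg _) (sum_abs_apply_single_le g)

/-- The functional on `(ℓ^∞)*` given by pairing the restriction to `c₀` with a sequence in the
unit ball of `ℓ^∞`. -/
theorem exists_dual_apply_eq_tsum (s : ℕ → Set.Icc (-1 : ℝ) 1) :
    ∃ G : (lp (fun _ : ℕ => ℝ) ⊤ →L[ℝ] ℝ) →L[ℝ] ℝ,
      ∀ g, G g = ∑' k, (s k : ℝ) * g (lp.single ⊤ k 1) := by
  have hle (g : lp (fun _ : ℕ => ℝ) ⊤ →L[ℝ] ℝ) (k : ℕ) :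
      ‖(s k : ℝ) * g (lp.single ⊤ k 1)‖ ≤ |g (lp.single ⊤ k 1)| := by
    rw [norm_mul]
    exact mul_le_of_le_one_left (abs_nonneg _) (abs_le.2 (s k).2)
  have hsum (g : lp (fun _ : ℕ => ℝ) ⊤ →L[ℝ] ℝ) :
      Summable fun k => (s k : ℝ) * g (lp.single ⊤ k 1) :=
    (summable_abs_apply_single g).of_norm_bounded (hle g)
  refine ⟨LinearMap.mkContinuous
    { toFun := fun g => ∑' k, (s k : ℝ) * g (lp.single ⊤ k 1)
      map_add' := fun g g' => by
        simp only [_root_.add_apply, mul_add]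
        exact (hsum g).tsum_add (hsum g')
      map_smul' := fun c g => by
        simp only [_root_.smul_apply, smul_eq_mul, RingHom.id_apply,
          mul_left_comm _ c]
        exact tsum_mul_left } 1 fun g => ?_, fun g => rfl⟩
  rw [one_mul]
  exact (tsum_of_norm_bounded (summable_abs_apply_single g).hasSum (hle g)).trans
    ((summable_abs_apply_single g).tsum_le_of_sum_le (sum_abs_apply_single_le g))

theorem abs_apply_le_of_tendsto_zero (g : lp (fun _ : ℕ => ℝ) ⊤ →L[ℝ] ℝ)
    (y : lp (fun _ : ℕ => ℝ) ⊤) (hy : Tendsto (fun k => y k) atTop (𝓝 0)) :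
    |g y| ≤ (∑' k, |g (lp.single ⊤ k 1)|) * ‖y‖ := by
  have hlim : Tendsto
      (fun N => ∑ k ∈ Finset.range N, y k • lp.single (E := fun _ : ℕ => ℝ) ⊤ k (1 : ℝ))
      atTop (𝓝 y) := by
    rw [Metric.tendsto_atTop] at hy ⊢
    intro ε hε
    obtain ⟨N, hN⟩ := hy (ε / 2) (half_pos hε)
    refine ⟨N, fun n hn => lt_of_le_of_lt ?_ (half_lt_self hε)⟩
    rw [dist_eq_norm]
    refine lp.norm_le_of_forall_le (half_pos hε).le fun j => ?_
    rw [lp.coeFn_sub, Pi.sub_apply, lp_sum_single_apply]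
    split_ifs with hj
    · simpa using (half_pos hε).le
    · have := hN j (hn.trans (by simpa using hj))
      simpa using this.le
  refine le_of_tendsto ((g.continuous.tendsto y).comp hlim).abs (Eventually.of_forall fun N => ?_)
  simp only [Function.comp_apply, map_sum, map_smul, smul_eq_mul]
  refine (Finset.abs_sum_le_sum_abs _ _).trans ?_
  calc ∑ k ∈ Finset.range N, |y k * g (lp.single ⊤ k 1)|
      ≤ ∑ k ∈ Finset.range N, |g (lp.single ⊤ k 1)| * ‖y‖ := by
        refine Finset.sum_le_sum fun k _ => ?_
        rw [abs_mul, mul_comm]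
        exact mul_le_mul_of_nonneg_left (lp.norm_apply_le_norm ENNReal.top_ne_zero y k)
          (abs_nonneg _)
    _ ≤ _ := by
        rw [← Finset.sum_mul]
        exact mul_le_mul_of_nonneg_right
          ((summable_abs_apply_single g).sum_le_tsum _ fun _ _ => abs_nonneg _) (norm_nonneg _)

/-- A weakly null sequence of functionals on `ℓ^∞` is uniformly null on bounded subsets of `c₀`. -/
theorem tendsto_apply_zero_of_bounded {g : ℕ → lp (fun _ : ℕ => ℝ) ⊤ →L[ℝ] ℝ}
    (hg : ∀ G : (lp (fun _ : ℕ => ℝ) ⊤ →L[ℝ] ℝ) →L[ℝ] ℝ, Tendsto (fun n => G (g n)) atTop (𝓝 0))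
    {y : ℕ → lp (fun _ : ℕ => ℝ) ⊤} (hy : ∀ n, Tendsto (fun k => y n k) atTop (𝓝 0))
    {C : ℝ} (hC : ∀ n, ‖y n‖ ≤ C) : Tendsto (fun n => g n (y n)) atTop (𝓝 0) := by
  have h := (tendsto_tsum_abs_zero_of_forall_tendsto (fun n => summable_abs_apply_single (g n))
    fun s => by
      obtain ⟨G, hG⟩ := exists_dual_apply_eq_tsum s
      exact (hg G).congr fun n => hG (g n)).mul_const C
  rw [zero_mul] at h
  refine squeeze_zero_norm (fun n => ?_) h
  exact (abs_apply_le_of_tendsto_zero (g n) (y n) (hy n)).trans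
    (mul_le_mul_of_nonneg_left (hC n) (tsum_nonneg fun _ => abs_nonneg _))

/-- The operator `T : L¹[0,1] → ℓ^∞`, `Tf = (∫₀¹ f(t) r_k⁺(t) dt)_k`, is weak
Dunford–Pettis but not Dunford–Pettis; in particular the Rademacher sequence `(r_n)` is
weakly null in `L¹[0,1]` while `‖T r_n‖_∞ ≥ 1/2` for all `n`. -/
theorem rademacher_operator_weakDP_not_DP
    (T : Lp ℝ 1 muI →L[ℝ] lp (fun _ : ℕ => ℝ) ⊤)
    (hT : ∀ f : Lp ℝ 1 muI, ∀ k : ℕ,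
      (T f : ∀ _ : ℕ, ℝ) k = ∫ t, f t * max (rademacher k t) 0 ∂muI)
    (R : ℕ → Lp ℝ 1 muI) (hR : ∀ k, (R k : ℝ → ℝ) =ᵐ[muI] rademacher k) :
    -- `T` is weak Dunford–Pettis
    (∀ x : ℕ → Lp ℝ 1 muI, ∀ g : ℕ → lp (fun _ : ℕ => ℝ) ⊤ →L[ℝ] ℝ,
      (∀ φ : Lp ℝ 1 muI →L[ℝ] ℝ, Tendsto (fun n => φ (x n)) atTop (𝓝 0)) →
      (∀ G : (lp (fun _ : ℕ => ℝ) ⊤ →L[ℝ] ℝ) →L[ℝ] ℝ,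
        Tendsto (fun n => G (g n)) atTop (𝓝 0)) →
      Tendsto (fun n => g n (T (x n))) atTop (𝓝 0)) ∧
    -- `T` is not Dunford–Pettis
    ¬ (∀ x : ℕ → Lp ℝ 1 muI,
        (∀ φ : Lp ℝ 1 muI →L[ℝ] ℝ, Tendsto (fun n => φ (x n)) atTop (𝓝 0)) →
        Tendsto (fun n => ‖T (x n)‖) atTop (𝓝 0)) ∧
    -- the Rademacher sequence is weakly null in `L¹[0,1]`
    (∀ φ : Lp ℝ 1 muI →L[ℝ] ℝ, Tendsto (fun n => φ (R n)) atTop (𝓝 0)) ∧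
    -- the key computation `∫₀¹ r_n r_n⁺ = 1/2` and the norm estimate
    (∀ n : ℕ, (∫ t, rademacher n t * max (rademacher n t) 0 ∂muI) = 1 / 2) ∧
    (∀ n : ℕ, (1 : ℝ) / 2 ≤ ‖T (R n)‖) := by
  have hnorm (n : ℕ) : (1 : ℝ) / 2 ≤ ‖T (R n)‖ := by
    refine le_trans (le_of_eq ?_) ((le_abs_self _).trans
      (lp.norm_apply_le_norm ENNReal.top_ne_zero (T (R n)) n))
    rw [hT, ← integral_rademacher_mul_posPart n]
    refine integral_congr_ae ?_
    filter_upwards [hR n] with t ht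
    rw [ht]
  refine ⟨fun x g hx hg => ?_, fun h => ?_, tendsto_apply_rademacher hR,
    integral_rademacher_mul_posPart, hnorm⟩
  · obtain ⟨C, hC⟩ := exists_norm_le_of_forall_tendsto_zero hx
    let a : ℕ → ℝ := fun n => (∫ t, x n t ∂muI) / 2
    have ha : Tendsto a atTop (𝓝 0) := by
      have := (hx (L1.integralCLM (α := ℝ) (E := ℝ) (μ := muI))).div_const 2
      rw [zero_div] at this
      refine this.congr fun n => ?_
      rw [← L1.integral_eq, L1.integral_eq_integral]
    have hacoord (n k : ℕ) : (T (x n) : ∀ _ : ℕ, ℝ) k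
        = a n + (∫ t, x n t * rademacher k t ∂muI) / 2 := by
      have hxi := L1.integrable_coeFn (x n)
      have hxr := integrable_mul_rademacher hxi k
      rw [hT, show a n = (∫ t, x n t ∂muI) / 2 from rfl, ← integral_div, ← integral_div,
        ← integral_add (hxi.div_const 2) (hxr.div_const 2)]
      refine integral_congr_ae ?_
      filter_upwards [rademacher_mul_self_ae k] with t ht
      rcases mul_self_eq_one_iff.1 ht with h | h <;> simp [h, neg_div]
    obtain ⟨A, hA⟩ := (Metric.isBounded_range_of_tendsto _ ha).exists_norm_le
    have hy := tendsto_apply_zero_of_bounded hg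
      (y := fun n => T (x n) - a n • (1 : lp (fun _ : ℕ => ℝ) ⊤)) (fun n => by
        have := (tendsto_integral_mul_rademacher (L1.integrable_coeFn (x n))).div_const 2
        rw [zero_div] at this
        refine this.congr fun k => ?_
        rw [lp.coeFn_sub, Pi.sub_apply, hacoord]
        simp)
      (C := ‖T‖ * C + A * ‖(1 : lp (fun _ : ℕ => ℝ) ⊤)‖) (fun n => by
        refine (norm_sub_le _ _).trans (add_le_add (T.le_opNorm_of_le (hC n)) ?_)
        rw [norm_smul]
        exact mul_le_mul_of_nonneg_right (hA _ ⟨n, rfl⟩) (norm_nonneg _))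
    have h1 := ha.mul (hg (ContinuousLinearMap.apply ℝ ℝ 1))
    have := hy.add h1
    rw [mul_zero, add_zero] at this
    refine this.congr fun n => ?_
    simp
  · obtain ⟨n, hn⟩ := ((h R (tendsto_apply_rademacher hR)).eventually_lt_const
      (one_half_pos (α := ℝ))).exists
    exact (hnorm n).not_gt hn
end

section
/- Let E = (⊕_{n=1}^∞ ℓ²_{2^n})₀ be the c₀-direct sum of the spaces ℓ²_{2^n}, let A_n be the 2ⁿ×2ⁿ Walsh matrices defined by A₁ = [[1,1],[1,-1]] and A_{n+1} = [[A_n, A_n],[A_n, -A_n]], and let T_n = 2^{-n/2} A_n (an isometry of ℓ²_{2^n}). Define T : E → E by Tx = (2^{-n/2} T_n x_n)_n. Then T is a compact operator, its modulus |T| exists and is given by |T|x = (2^{-n/2} |T_n| x_n)_n where |T_n| has all matrix entries 2^{-n/2}, and |T| is not almost Dunford–Pettis: the disjoint weakly null sequence (x_n) in E whose only nonzero block is the n-th block (2^{-n/2},...,2^{-n/2}) ∈ ℓ²_{2^n} satisfies ‖|T|x_n‖ = 1 for all n. -/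
open Filter Topology

/-- The block `ℓ²_{2^n}` (for `n = 1, 2, …`, encoded as `n+1` for `n : ℕ`). -/
abbrev XB (n : ℕ) : Type := EuclideanSpace ℝ (Fin (2 ^ (n + 1)))

/-- The Walsh matrices: `A₁ = [[1,1],[1,-1]]` and
`A_{n+1} = [[A_n, A_n],[A_n, -A_n]]`. -/
noncomputable def walsh : (n : ℕ) → Matrix (Fin (2 ^ (n + 1))) (Fin (2 ^ (n + 1))) ℝ
  | 0 => Matrix.reindex (finCongr (by norm_num)) (finCongr (by norm_num)) !![1, 1; 1, -1]
  | n + 1 =>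
    Matrix.reindex (finSumFinEquiv.trans (finCongr (by ring)))
      (finSumFinEquiv.trans (finCongr (by ring)))
      (Matrix.fromBlocks (walsh n) (walsh n) (walsh n) (-(walsh n)))

/-- The `i`-th coordinate of the `m`-th block of `x`. -/
def blk (x : lp XB ⊤) (m : ℕ) (i : Fin (2 ^ (m + 1))) : ℝ := x m i

/-- The `c₀`-direct sum `E = (⊕ₙ ℓ²_{2ⁿ})₀`: the elements `x` of the sup-normed
direct sum with `‖xₙ‖ → 0`. -/
noncomputable def c0S : Submodule ℝ (lp XB ⊤) where
  carrier := {x | Tendsto (fun n => ‖x n‖) atTop (𝓝 0)}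
  zero_mem' := by
    simp only [Set.mem_setOf_eq, lp.coeFn_zero, Pi.zero_apply, norm_zero]
    exact tendsto_const_nhds
  add_mem' := by
    intro a b ha hb
    have h := ha.add hb
    rw [add_zero] at h
    refine squeeze_zero (fun n => norm_nonneg _) (fun n => ?_) h
    have : (↑(a + b) : ∀ n, XB n) n = a n + b n := by rw [lp.coeFn_add]; rfl
    rw [this]
    exact norm_add_le _ _
  smul_mem' := by
    intro c x hx
    have h := hx.const_mul ‖c‖
    rw [mul_zero] at h
    refine squeeze_zero (fun n => norm_nonneg _) (fun n => ?_) h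
    have : (↑(c • x) : ∀ n, XB n) n = c • x n := by rw [lp.coeFn_smul]; rfl
    rw [this, norm_smul]

/-- A vector of `E` is positive iff all its coordinates are nonnegative. -/
def PosVec (x : c0S) : Prop := ∀ m i, 0 ≤ blk (x : lp XB ⊤) m i

/-- The operator order on `L(E)`. -/
def OpLEc (S T : c0S →L[ℝ] c0S) : Prop :=
  ∀ x : c0S, PosVec x → ∀ m i, blk ((S x : c0S) : lp XB ⊤) m i ≤ blk ((T x : c0S) : lp XB ⊤) m i

/-- `M` is the modulus of `T`: the least upper bound of `T` and `-T` in the operator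
order. -/
def IsModulusC (T M : c0S →L[ℝ] c0S) : Prop :=
  OpLEc T M ∧ OpLEc (-T) M ∧ ∀ U : c0S →L[ℝ] c0S, OpLEc T U → OpLEc (-T) U → OpLEc M U

/-- An operator on `E` is almost Dunford–Pettis if it maps disjoint weakly null
sequences to norm-null sequences. -/
def AlmostDPc (S : c0S →L[ℝ] c0S) : Prop :=
  ∀ x : ℕ → c0S,
    (∀ n n', n ≠ n' → ∀ m i,
      min |blk ((x n : c0S) : lp XB ⊤) m i| |blk ((x n' : c0S) : lp XB ⊤) m i| = 0) →
    (∀ φ : c0S →L[ℝ] ℝ, Tendsto (fun n => φ (x n)) atTop (𝓝 0)) →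
    Tendsto (fun n => ‖S (x n)‖) atTop (𝓝 0)

theorem walsh_transpose_mul_self (n : ℕ) :
    (walsh n).transpose * walsh n = (2 ^ (n + 1) : ℝ) • 1 := by
  induction n with
  | zero =>
    ext i j
    rw [Matrix.mul_apply]
    refine (Fin.sum_univ_two _).trans ?_
    fin_cases i <;> fin_cases j <;> norm_num [walsh, Matrix.one_apply, finCongr]
  | succ n ih =>
    simp only [walsh, Matrix.reindex_apply, Matrix.transpose_submatrix, Matrix.submatrix_mul_equiv,
      Matrix.fromBlocks_transpose, Matrix.fromBlocks_multiply, Matrix.transpose_neg,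
      Matrix.neg_mul, Matrix.mul_neg, neg_neg, ih, add_neg_cancel]
    have hblocks (c : ℝ) : Matrix.fromBlocks (c • 1) 0 0 (c • 1) =
        c • (1 : Matrix (Fin (2 ^ (n + 1)) ⊕ Fin (2 ^ (n + 1)))
          (Fin (2 ^ (n + 1)) ⊕ Fin (2 ^ (n + 1))) ℝ) := by
      rw [← Matrix.fromBlocks_one, Matrix.fromBlocks_smul, smul_zero]
    rw [← add_smul, ← two_mul, ← pow_succ', hblocks, Matrix.submatrix_smul, Pi.smul_apply,
      Pi.smul_apply, Matrix.submatrix_one_equiv]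

theorem abs_walsh (n : ℕ) (i j : Fin (2 ^ (n + 1))) : |walsh n i j| = 1 := by
  induction n with
  | zero => fin_cases i <;> fin_cases j <;> norm_num [walsh, finCongr]
  | succ n ih =>
    simp only [walsh, Matrix.reindex_apply, Matrix.submatrix_apply]
    generalize (finSumFinEquiv.trans (finCongr _)).symm i = a
    generalize (finSumFinEquiv.trans (finCongr _)).symm j = b
    rcases a with a | a <;> rcases b with b | b <;> simp [ih]

theorem sum_sq_walsh_mulVec (n : ℕ) (v : Fin (2 ^ (n + 1)) → ℝ) :
    ∑ i, (∑ j, walsh n i j * v j) ^ 2 = 2 ^ (n + 1) * ∑ j, v j ^ 2 := by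
  have h : (walsh n).mulVec v ⬝ᵥ (walsh n).mulVec v = 2 ^ (n + 1) * (v ⬝ᵥ v) := by
    rw [Matrix.dotProduct_mulVec, Matrix.vecMul_mulVec, walsh_transpose_mul_self,
      Matrix.vecMul_smul, Matrix.vecMul_one, smul_dotProduct, smul_eq_mul]
  simpa only [dotProduct, Matrix.mulVec, ← sq] using h

/-- The coordinate functionals of `c0S`. -/
noncomputable def coordLM (m : ℕ) (i : Fin (2 ^ (m + 1))) : c0S →ₗ[ℝ] ℝ where
  toFun x := blk (x : lp XB ⊤) m i
  map_add' _ _ := rfl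
  map_smul' _ _ := rfl

theorem coordLM_apply (m : ℕ) (i : Fin (2 ^ (m + 1))) (x : c0S) :
    coordLM m i x = blk (x : lp XB ⊤) m i := rfl

/-- The projection of `c0S` onto a block. -/
noncomputable def blockCLM (m : ℕ) : c0S →L[ℝ] XB m :=
  (lp.evalCLM ℝ XB ⊤ m).comp c0S.subtypeL

theorem norm_sq_blockCLM (m : ℕ) (x : c0S) :
    ‖blockCLM m x‖ ^ 2 = ∑ i, blk (x : lp XB ⊤) m i ^ 2 := by
  rw [EuclideanSpace.real_norm_sq_eq]
  rfl

theorem norm_blockCLM_le (m : ℕ) (x : c0S) : ‖blockCLM m x‖ ≤ ‖x‖ :=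
  lp.norm_apply_le_norm (by simp) (x : lp XB ⊤) m

theorem norm_le_of_norm_blockCLM_le {x : c0S} {C : ℝ} (hC : 0 ≤ C)
    (h : ∀ m, ‖blockCLM m x‖ ≤ C) : ‖x‖ ≤ C :=
  lp.norm_le_of_forall_le (f := (x : lp XB ⊤)) hC h

/-- The inclusion of a block into `c0S`. -/
noncomputable def insertCLM (n : ℕ) : XB n →L[ℝ] c0S :=
  LinearMap.toContinuousLinearMap <|
    (lp.lsingle (𝕜 := ℝ) (E := XB) ⊤ n).codRestrict c0S fun v => by
      refine tendsto_const_nhds.congr' ?_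
      filter_upwards [eventually_gt_atTop n] with m hm
      simp [Pi.single_eq_of_ne hm.ne']

theorem blockCLM_insertCLM (n m : ℕ) (v : XB n) :
    blockCLM m (insertCLM n v) = Pi.single (M := XB) n v m := rfl

theorem isClosed_c0S : IsClosed (c0S : Set (lp XB ⊤)) := by
  refine isClosed_of_closure_subset fun x hx => ?_
  change Tendsto (fun n => ‖x n‖) atTop (𝓝 0)
  rw [Metric.tendsto_atTop]
  intro ε hε
  obtain ⟨y, hy, hxy⟩ := Metric.mem_closure_iff.1 hx (ε / 2) (half_pos hε)
  obtain ⟨N, hN⟩ := Metric.tendsto_atTop.1 (show Tendsto (fun n => ‖y n‖) atTop (𝓝 0) from hy)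
    (ε / 2) (half_pos hε)
  refine ⟨N, fun n hn => ?_⟩
  have h1 := hN n hn
  have h2 : ‖x n - y n‖ ≤ ‖x - y‖ := lp.norm_apply_le_norm (by simp) (x - y) n
  have h3 := norm_le_norm_sub_add (x n) (y n)
  rw [dist_eq_norm] at hxy
  simp only [dist_zero_right, norm_norm] at h1 ⊢
  linarith

instance : CompleteSpace c0S := isClosed_c0S.completeSpace_coe

/-- The projection of `c0S` onto its first `N` blocks. -/
noncomputable def truncCLM (N : ℕ) : c0S →L[ℝ] c0S :=
  ∑ n ∈ Finset.range N, (insertCLM n).comp (blockCLM n)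

theorem blockCLM_truncCLM (N m : ℕ) (x : c0S) :
    blockCLM m (truncCLM N x) = if m < N then blockCLM m x else 0 := by
  simp only [truncCLM, sum_apply, ContinuousLinearMap.comp_apply, map_sum,
    blockCLM_insertCLM]
  rw [Finset.sum_pi_single m (fun n => blockCLM n x)]
  simp

theorem isCompactOperator_truncCLM (N : ℕ) : IsCompactOperator (truncCLM N) := by
  have h : truncCLM N ∈ compactOperator (RingHom.id ℝ) c0S c0S :=
    Submodule.sum_mem _ fun n _ =>
      (isCompactOperator_of_locallyCompactSpace_rng (insertCLM n)).comp_clm (blockCLM n)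
  exact h

/-- An operator on `c0S` whose blocks have norms dominated by a sequence decreasing to zero is
compact. -/
theorem isCompactOperator_of_norm_blockCLM_le (T : c0S →L[ℝ] c0S) (b : ℕ → ℝ) (hb : Antitone b)
    (hb0 : Tendsto b atTop (𝓝 0)) (hT : ∀ x m, ‖blockCLM m (T x)‖ ≤ b m * ‖x‖) :
    IsCompactOperator T := by
  have hnn : ∀ n, 0 ≤ b n := fun n => hb.le_of_tendsto hb0 n
  refine isCompactOperator_of_tendsto (l := atTop) (F := fun N => (truncCLM N).comp T) ?_
    (Eventually.of_forall fun N => (isCompactOperator_truncCLM N).comp_clm T)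
  refine (tendsto_iff_norm_sub_tendsto_zero (E := c0S →L[ℝ] c0S)).2 ?_
  refine squeeze_zero (fun N => ContinuousLinearMap.opNorm_nonneg _) (fun N => ?_) hb0
  refine ContinuousLinearMap.opNorm_le_bound _ (hnn N) fun x => ?_
  refine norm_le_of_norm_blockCLM_le (mul_nonneg (hnn N) (norm_nonneg x)) fun m => ?_
  rw [sub_apply, map_sub, ContinuousLinearMap.comp_apply, blockCLM_truncCLM]
  split_ifs with h
  · simpa using mul_nonneg (hnn N) (norm_nonneg x)
  · rw [zero_sub, norm_neg]
    exact (hT x m).trans (mul_le_mul_of_nonneg_right (hb (not_lt.1 h)) (norm_nonneg x))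

/-- A norm bounded sequence of block vectors in different blocks is weakly null. -/
theorem tendsto_clm_of_blockCLM_eq_zero (xs : ℕ → c0S) (h0 : ∀ n m, m ≠ n → blockCLM m (xs n) = 0)
    (h1 : ∀ n, ‖blockCLM n (xs n)‖ ≤ 1) (φ : c0S →L[ℝ] ℝ) :
    Tendsto (fun n => φ (xs n)) atTop (𝓝 0) := by
  have hs : Summable fun n => |φ (xs n)| := by
    refine summable_of_sum_le (c := ‖φ‖) (fun n => abs_nonneg _) fun s => ?_
    set z : c0S := ∑ n ∈ s, (SignType.sign (φ (xs n)) : ℝ) • xs n with hz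
    have hφ : φ z = ∑ n ∈ s, |φ (xs n)| := by
      simp [hz, map_sum, sign_mul_self]
    have hz1 : ‖z‖ ≤ 1 := by
      refine norm_le_of_norm_blockCLM_le zero_le_one fun m => ?_
      simp only [hz, map_sum, map_smul]
      by_cases hm : m ∈ s
      · rw [Finset.sum_eq_single_of_mem m hm fun n _ hn => by rw [h0 n m hn.symm, smul_zero],
          norm_smul]
        refine mul_le_one₀ ?_ (norm_nonneg _) (h1 m)
        rcases SignType.sign (φ (xs m)) <;> simp
      · rw [Finset.sum_eq_zero fun n hn => by
          rw [h0 n m (fun h => hm (h ▸ hn)), smul_zero]]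
        simp
    calc ∑ n ∈ s, |φ (xs n)| = φ z := hφ.symm
      _ ≤ ‖φ z‖ := le_abs_self _
      _ ≤ ‖φ‖ * ‖z‖ := φ.le_opNorm z
      _ ≤ ‖φ‖ := mul_le_of_le_one_right φ.opNorm_nonneg hz1
  exact (tendsto_zero_iff_abs_tendsto_zero _).2 hs.tendsto_atTop_zero

/-- The coordinate unit vectors of `c0S`. -/
noncomputable def unitVec (m : ℕ) (j : Fin (2 ^ (m + 1))) : c0S :=
  insertCLM m (EuclideanSpace.single j 1)

theorem blk_unitVec_self (m : ℕ) (i j : Fin (2 ^ (m + 1))) :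
    blk (unitVec m j : lp XB ⊤) m i = if i = j then 1 else 0 := by
  change (blockCLM m (insertCLM m (EuclideanSpace.single j 1))) i = _
  rw [blockCLM_insertCLM, Pi.single_eq_same]
  simp

theorem blk_unitVec_of_ne {m k : ℕ} (h : k ≠ m) (j : Fin (2 ^ (m + 1))) (i : Fin (2 ^ (k + 1))) :
    blk (unitVec m j : lp XB ⊤) k i = 0 := by
  change (blockCLM k (insertCLM m (EuclideanSpace.single j 1))) i = _
  rw [blockCLM_insertCLM, Pi.single_eq_of_ne h]
  rfl

theorem posVec_unitVec (m : ℕ) (j : Fin (2 ^ (m + 1))) : PosVec (unitVec m j) := by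
  intro k i
  rcases eq_or_ne k m with rfl | h
  · rw [blk_unitVec_self]
    split_ifs <;> norm_num
  · rw [blk_unitVec_of_ne h]

theorem posVec_sub_sum_unitVec {x : c0S} (hx : PosVec x) (m : ℕ) :
    PosVec (x - ∑ j, blk (x : lp XB ⊤) m j • unitVec m j) := by
  intro k i
  rw [← coordLM_apply, map_sub, map_sum]
  simp only [map_smul, coordLM_apply, smul_eq_mul]
  rcases eq_or_ne k m with rfl | h
  · simp [blk_unitVec_self]
  · simpa [blk_unitVec_of_ne h] using hx k i

theorem isModulusC_of_walsh (T M : c0S →L[ℝ] c0S)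
    (hT : ∀ x : c0S, ∀ m i, blk ((T x : c0S) : lp XB ⊤) m i =
      (∑ j, walsh m i j * blk (x : lp XB ⊤) m j) / 2 ^ (m + 1))
    (hM : ∀ x : c0S, ∀ m (i : Fin (2 ^ (m + 1))), blk ((M x : c0S) : lp XB ⊤) m i =
      (∑ j, blk (x : lp XB ⊤) m j) / 2 ^ (m + 1)) :
    IsModulusC T M := by
  have hneg : ∀ (x : c0S) m i, blk (((-T) x : c0S) : lp XB ⊤) m i =
      -blk ((T x : c0S) : lp XB ⊤) m i := fun x m i => rfl
  refine ⟨fun x hx m i => ?_, fun x hx m i => ?_, fun U hU hU' x hx m i => ?_⟩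
  · rw [hT, hM]
    gcongr with j
    exact mul_le_of_le_one_left (hx m j) ((le_abs_self _).trans (abs_walsh m i j).le)
  · rw [hneg, hT, hM, ← neg_div, ← Finset.sum_neg_distrib]
    gcongr with j
    rw [← neg_mul]
    exact mul_le_of_le_one_left (hx m j) ((neg_le_abs _).trans (abs_walsh m i j).le)
  · have hpos : ∀ y, PosVec y → 0 ≤ blk ((U y : c0S) : lp XB ⊤) m i := fun y hy => by
      have h1 := hU y hy m i
      have h2 := hU' y hy m i
      rw [hneg] at h2
      linarith
    have hunit : ∀ j, 1 / 2 ^ (m + 1) ≤ blk ((U (unitVec m j) : c0S) : lp XB ⊤) m i := fun j => by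
      have h1 := hU _ (posVec_unitVec m j) m i
      have h2 := hU' _ (posVec_unitVec m j) m i
      have h3 : blk ((T (unitVec m j) : c0S) : lp XB ⊤) m i = walsh m i j / 2 ^ (m + 1) := by
        simp [hT, blk_unitVec_self]
      rw [hneg] at h2
      rw [← abs_walsh m i j, ← abs_of_pos (show (0 : ℝ) < 2 ^ (m + 1) by positivity), ← abs_div,
        ← h3]
      exact abs_le'.2 ⟨h1, h2⟩
    have h := hpos _ (posVec_sub_sum_unitVec hx m)
    rw [← coordLM_apply, map_sub, map_sub, map_sum, map_sum] at h
    simp only [map_smul, coordLM_apply, smul_eq_mul] at h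
    rw [hM, Finset.sum_div]
    refine le_trans (Finset.sum_le_sum fun j _ => ?_) (sub_nonneg.1 h)
    rw [div_eq_mul_one_div]
    exact mul_le_mul_of_nonneg_left (hunit j) (hx m j)

/-- Krengel's example: with `E = (⊕ₙ ℓ²_{2ⁿ})₀` and `T_n = 2^{-n/2} A_n` the Walsh
isometries, the operator `Tx = (2^{-n/2} T_n x_n)ₙ` is compact, its modulus `|T|`
exists and is given blockwise by `2^{-n/2}|T_n|`, where all entries of `|T_n|` are
`2^{-n/2}`, but `|T|` is not almost Dunford–Pettis: the disjoint weakly null sequence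
`(x_n)` whose only nonzero block is the `n`-th block `(2^{-n/2},…,2^{-n/2})` satisfies
`‖|T| x_n‖ = 1` for all `n`. -/
theorem krengel_example
    (T M : c0S →L[ℝ] c0S)
    (hT : ∀ x : c0S, ∀ m i, blk ((T x : c0S) : lp XB ⊤) m i =
      (∑ j, walsh m i j * blk (x : lp XB ⊤) m j) / 2 ^ (m + 1))
    (hM : ∀ x : c0S, ∀ m (i : Fin (2 ^ (m + 1))), blk ((M x : c0S) : lp XB ⊤) m i =
      (∑ j, blk (x : lp XB ⊤) m j) / 2 ^ (m + 1))
    (xs : ℕ → c0S)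
    (hxs : ∀ n m i, blk ((xs n : c0S) : lp XB ⊤) m i =
      if m = n then (Real.sqrt (2 ^ (n + 1)))⁻¹ else 0) :
    IsCompactOperator T ∧
    IsModulusC T M ∧
    (∀ n n', n ≠ n' → ∀ m i,
      min |blk ((xs n : c0S) : lp XB ⊤) m i| |blk ((xs n' : c0S) : lp XB ⊤) m i| = 0) ∧
    (∀ φ : c0S →L[ℝ] ℝ, Tendsto (fun n => φ (xs n)) atTop (𝓝 0)) ∧
    (∀ n, ‖M (xs n)‖ = 1) ∧
    ¬ AlmostDPc M := by
  have hTb : ∀ x m, ‖blockCLM m (T x)‖ ≤ Real.sqrt ((1 / 2) ^ (m + 1)) * ‖x‖ := fun x m => by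
    refine le_of_sq_le_sq ?_ (by positivity)
    rw [norm_sq_blockCLM, mul_pow, Real.sq_sqrt (by positivity)]
    simp only [hT, div_pow]
    rw [← Finset.sum_div, sum_sq_walsh_mulVec, ← norm_sq_blockCLM]
    have h := pow_le_pow_left₀ (norm_nonneg _) (norm_blockCLM_le m x) 2
    calc _ = 1 ^ (m + 1) / 2 ^ (m + 1) * ‖blockCLM m x‖ ^ 2 := by field_simp; simp
      _ ≤ _ := by gcongr
  have hdisj : ∀ n n', n ≠ n' → ∀ m i,
      min |blk ((xs n : c0S) : lp XB ⊤) m i| |blk ((xs n' : c0S) : lp XB ⊤) m i| = 0 := by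
    intro n n' hn m i
    rcases ne_or_eq m n with h | rfl
    · rw [hxs n, if_neg h, abs_zero]
      exact min_eq_left (abs_nonneg _)
    · rw [hxs n', if_neg hn, abs_zero]
      exact min_eq_right (abs_nonneg _)
  have hblock0 : ∀ n m, m ≠ n → blockCLM m (xs n) = 0 := fun n m h => by
    ext i
    exact (hxs n m i).trans (if_neg h)
  have hblock1 : ∀ n, ‖blockCLM n (xs n)‖ = 1 := fun n => by
    rw [← sq_eq_sq₀ (norm_nonneg _) zero_le_one, norm_sq_blockCLM]
    simp [hxs]
  have hMxs : ∀ n, M (xs n) = xs n := fun n => by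
    refine Subtype.ext (lp.ext (funext fun m => ?_))
    ext i
    change blk _ m i = blk _ m i
    rw [hM]
    simp only [hxs]
    split_ifs <;> simp
  have hweak := tendsto_clm_of_blockCLM_eq_zero xs hblock0 fun n => (hblock1 n).le
  have hnorm : ∀ n, ‖M (xs n)‖ = 1 := fun n => by
    rw [hMxs]
    refine le_antisymm (norm_le_of_norm_blockCLM_le zero_le_one fun m => ?_)
      ((hblock1 n).ge.trans (norm_blockCLM_le n _))
    rcases eq_or_ne m n with rfl | h
    · exact (hblock1 m).le
    · simp [hblock0 n m h]
  refine ⟨?_, isModulusC_of_walsh T M hT hM, hdisj, hweak, hnorm, fun h => ?_⟩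
  · refine isCompactOperator_of_norm_blockCLM_le T _ (fun a b hab => ?_) ?_ hTb
    · exact Real.sqrt_le_sqrt (pow_le_pow_of_le_one (by norm_num) (by norm_num) (by lia))
    · have h := (tendsto_pow_atTop_nhds_zero_of_lt_one (r := (1 / 2 : ℝ)) (by norm_num)
        (by norm_num)).comp (tendsto_add_atTop_nat 1)
      simpa [Function.comp_def] using (Real.continuous_sqrt.tendsto 0).comp h
  · have h0 := h xs hdisj hweak
    simp only [hnorm] at h0
    exact one_ne_zero (tendsto_nhds_unique tendsto_const_nhds h0)
end
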